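/- arXiv:2208.06317 — 4 statements merged into one kernel-verified Lean document; each statement's English description precedes it below -/
import Mathlib

section
/- For all x ∈ K and r ∈ R the following hold: (1) (x ◁ r)^{-1} = x^{-1} ◁ (x ▷ r); (2) (x ▷ r)^R = (x ◁ r) ▷ r^R; (3) τ(r, r^R)^{-1} ◁ r = τ(r^R, r^{RR})^{-1}; (4) τ(r, r^R) ▷ r^{RR} = r, equivalently τ(r, r^R)^{-1} ▷ r = r^{RR}. -/
/-- Identities relating the right inverse map `( )^R`, the actions
`▷`, `◁` and the cocycle `τ` for a transversal `R` of `K ⊆ G`: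
(1) `(x ◁ r)⁻¹ = x⁻¹ ◁ (x ▷ r)`;
(2) `(x ▷ r)^R = (x ◁ r) ▷ r^R`;
(3) `τ(r, r^R)⁻¹ ◁ r = τ(r^R, r^{RR})⁻¹`;
(4) `τ(r, r^R) ▷ r^{RR} = r`, equivalently `τ(r, r^R)⁻¹ ▷ r = r^{RR}`. -/
theorem stmt_4 (G : Type) [Group G] (K : Subgroup G) (R : Set G)
    (hR1 : (1 : G) ∈ R)
    (hfact : ∀ g : G, ∃! p : R × K, g = (p.1 : G) * ((p.2 : K) : G))
    (act : K → R → R) (coact : K → R → K)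
    (mul : R → R → R) (tau : R → R → K)
    (hact : ∀ (x : K) (r : R), (x : G) * (r : G) = (act x r : G) * ((coact x r : K) : G))
    (hmul : ∀ r s : R, (r : G) * (s : G) = (mul r s : G) * ((tau r s : K) : G))
    (rinv : R → R)
    (hrinv : ∀ r : R, mul r (rinv r) = ⟨1, hR1⟩) :
    (∀ (x : K) (r : R), (coact x r)⁻¹ = coact x⁻¹ (act x r)) ∧
    (∀ (x : K) (r : R), rinv (act x r) = act (coact x r) (rinv r)) ∧
    (∀ r : R, coact (tau r (rinv r))⁻¹ r = (tau (rinv r) (rinv (rinv r)))⁻¹) ∧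
    (∀ r : R, act (tau r (rinv r)) (rinv (rinv r)) = r ∧
      act (tau r (rinv r))⁻¹ r = rinv (rinv r)) := by
  have uniq : ∀ (a b : R) (x y : K), (a : G) * (x : G) = (b : G) * (y : G) → a = b ∧ x = y := by
    intro a b x y h
    have := (hfact ((a : G) * (x : G))).unique (y₁ := (a, x)) (y₂ := (b, y)) rfl h
    exact ⟨congrArg Prod.fst this, congrArg Prod.snd this⟩
  have ht : ∀ r : R, (r : G) * (rinv r : G) = (tau r (rinv r) : G) := by
    intro r
    have h := hmul r (rinv r)
    rw [hrinv] at h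
    simpa using h
  have hi : ∀ r : R, (rinv r : G) = (r : G)⁻¹ * (tau r (rinv r) : G) := by
    intro r
    rw [← ht]
    group
  have h34 : ∀ r : R, act (tau r (rinv r))⁻¹ r = rinv (rinv r) ∧
      coact (tau r (rinv r))⁻¹ r = (tau (rinv r) (rinv (rinv r)))⁻¹ := by
    intro r
    apply uniq
    rw [← hact]
    push_cast
    rw [← ht r, ← ht (rinv r)]
    group
  refine ⟨?_, ?_, fun r => (h34 r).2, fun r => ⟨?_, (h34 r).1⟩⟩
  · intro x r
    refine (uniq r (act x⁻¹ (act x r)) _ _ ?_).2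
    rw [← hact]
    have h : (act x r : G) = x * r * (coact x r : G)⁻¹ := by rw [hact]; group
    rw [h]
    push_cast
    group
  · intro x r
    refine (uniq _ _ ((tau (act x r) (rinv (act x r)))⁻¹ * x * tau r (rinv r))
      (coact (coact x r) (rinv r)) ?_).1
    rw [← hact]
    have h : (coact x r : G) = (act x r : G)⁻¹ * (x * r) := by rw [hact]; group
    rw [h]
    push_cast
    rw [← ht r, ← ht (act x r)]
    group
  · refine (uniq _ _ (coact (tau r (rinv r)) (rinv (rinv r)))
      (tau (rinv r) (rinv (rinv r))) ?_).1
    rw [← hact, ← ht r, ← ht (rinv r)]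
    group
end

section
/- Let B be a finite-dimensional semisimple algebra over ℂ and A ⊆ B a subalgebra containing 1_B which is itself semisimple. Let V be a simple finite-dimensional A-module and W a simple finite-dimensional B-module. Let P_V ∈ A be the central idempotent of A acting as the identity on V and as zero on every simple A-module not isomorphic to V, and let P_W ∈ B be the analogous central idempotent of B for W. Then dim_ℂ Hom_A(V, W|_A) = Tr(L_{P_V P_W}) / (dim_ℂ V · dim_ℂ W), where W|_A is W regarded as an A-module by restriction and L_b : B → B denotes left multiplication by b ∈ B. Moreover, P_V P_W = 0 if and only if Hom_A(V, W|_A) = 0. -/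
/-- The space `Hom_A(V, W|_A)` of `A`-module maps from `V` to the restriction of the
`B`-module `W` along the subalgebra `A ⊆ B`, as a submodule of `V →ₗ[ℂ] W`. -/
def homRes (B : Type) [Ring B] [Algebra ℂ B] (A : Subalgebra ℂ B)
    (V : Type) [AddCommGroup V] [Module ℂ V] [Module A V]
    (W : Type) [AddCommGroup W] [Module ℂ W] [Module B W] [IsScalarTower ℂ B W] :
    Submodule ℂ (V →ₗ[ℂ] W) where
  carrier := {f | ∀ (a : A) (v : V), f (a • v) = (a : B) • f v}
  add_mem' := by
    intro f g hf hg a v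
    simp [hf a v, hg a v, smul_add]
  zero_mem' := by intro a v; simp
  smul_mem' := by
    intro c f hf a v
    simp only [LinearMap.smul_apply, hf a v]
    rw [smul_comm]

theorem aux_zero (B : Type) [Ring B] [IsSemisimpleRing B] (x : B)
    (h : ∀ (M : Type) [AddCommGroup M] [Module B M], IsSimpleModule B M → ∀ m : M, x • m = 0) :
    x = 0 := by
  have key : ∀ y : B, x * y = 0 := by
    intro y
    have hy : y ∈ sSup { m : Submodule B B | IsSimpleModule B m } := by
      rw [IsSemisimpleModule.sSup_simples_eq_top]; trivial
    rw [sSup_eq_iSup'] at hy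
    induction hy using Submodule.iSup_induction' with
    | mem i z hz =>
      have := h i.1 i.2 ⟨z, hz⟩
      simpa using congrArg Subtype.val this
    | zero => simp
    | add a b _ _ ha hb => rw [mul_add, ha, hb, add_zero]
  simpa using key 1

theorem aux_trace_end (W : Type) [AddCommGroup W] [Module ℂ W] [FiniteDimensional ℂ W]
    (f : Module.End ℂ W) :
    LinearMap.trace ℂ (Module.End ℂ W) (LinearMap.mulLeft ℂ f)
      = (Module.finrank ℂ W : ℂ) * LinearMap.trace ℂ W f := by
  have h := LinearMap.trace_conj' (R := ℂ)
    (TensorProduct.map (LinearMap.id : Module.Dual ℂ W →ₗ[ℂ] _) f) (dualTensorHomEquiv ℂ W W)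
  rw [LinearMap.trace_tensorProduct', LinearMap.trace_id, Subspace.dual_finrank_eq] at h
  rw [← h]
  congr 1
  rw [LinearEquiv.conj_apply]
  apply LinearMap.ext
  intro g
  obtain ⟨t, rfl⟩ := (dualTensorHomEquiv ℂ W W).surjective g
  simp only [LinearMap.comp_apply, LinearEquiv.coe_coe, LinearEquiv.symm_apply_apply]
  induction t using TensorProduct.induction_on with
  | zero => simp
  | add a b ha hb => simp only [map_add, ha, hb]
  | tmul a b =>
    apply LinearMap.ext
    intro w
    simp [dualTensorHomEquiv]

theorem aux_surj (B : Type) [Ring B] [Algebra ℂ B]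
    (W : Type) [AddCommGroup W] [Module ℂ W] [Module B W] [IsScalarTower ℂ B W]
    [FiniteDimensional ℂ W] [IsSimpleModule B W] :
    Function.Surjective (Algebra.lsmul ℂ ℂ W : B →ₐ[ℂ] Module.End ℂ W) := by
  intro f
  have hb := IsSimpleModule.algebraMap_end_bijective_of_isAlgClosed (A := B) (V := W) ℂ
  let f' : Module.End (Module.End B W) W :=
    { toFun := f
      map_add' := f.map_add
      map_smul' := by
        intro g w
        obtain ⟨c, rfl⟩ := hb.2 g
        simp [Module.algebraMap_end_apply] }
  obtain ⟨s, hs⟩ := Module.Finite.fg_top (R := ℂ) (M := W)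
  obtain ⟨r, hr⟩ := jacobson_density (R := B) f' s
  refine ⟨r, LinearMap.ext_on hs ?_⟩
  intro m hm
  exact (hr m hm).symm

theorem aux_one (B : Type) [Ring B] [Algebra ℂ B]
    [FiniteDimensional ℂ B] [IsSemisimpleRing B]
    (W : Type) [AddCommGroup W] [Module ℂ W] [Module B W] [IsScalarTower ℂ B W]
    [FiniteDimensional ℂ W] [IsSimpleModule B W]
    (PW : B)
    (hPWcentral : ∀ b : B, PW * b = b * PW)
    (hPWone : ∀ w : W, PW • w = w)
    (hz : ∀ x : B, (∀ w : W, x • w = 0) → x * PW = 0) (b : B) :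
    LinearMap.trace ℂ B (LinearMap.mulLeft ℂ (b * PW))
      = (Module.finrank ℂ W : ℂ) * LinearMap.trace ℂ W (Algebra.lsmul ℂ ℂ W b) := by
  let φ : B →ₗ[ℂ] Module.End ℂ W := (Algebra.lsmul ℂ ℂ W : B →ₐ[ℂ] Module.End ℂ W).toLinearMap
  have hφ : ∀ x w, φ x w = x • w := fun _ _ => rfl
  obtain ⟨s, hs⟩ := LinearMap.exists_rightInverse_of_surjective φ
    (LinearMap.range_eq_top.2 (aux_surj B W))
  have hs' : ∀ g, φ (s g) = g := fun g => LinearMap.congr_fun hs g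
  have e1 : LinearMap.mulLeft ℂ (b * PW) = (LinearMap.mulLeft ℂ (b * PW) ∘ₗ s) ∘ₗ φ := by
    apply LinearMap.ext
    intro x
    have : (x - s (φ x)) * PW = 0 := by
      apply hz
      intro w
      rw [← hφ, map_sub, hs', sub_self]; rfl
    rw [← hPWcentral, mul_sub, sub_eq_zero] at this
    simp only [LinearMap.comp_apply, LinearMap.mulLeft_apply, mul_assoc, this]
  rw [← aux_trace_end, e1, LinearMap.trace_comp_comm']
  congr 1
  apply LinearMap.ext
  intro g
  apply LinearMap.ext
  intro w
  have := LinearMap.congr_fun (hs' g) w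
  rw [hφ] at this
  simp only [LinearMap.comp_apply, LinearMap.mulLeft_apply, hφ, mul_smul, this, hPWone]
  rfl

theorem aux_two (B : Type) [Ring B] [Algebra ℂ B]
    (A : Subalgebra ℂ B) [IsSemisimpleRing A]
    (V : Type) [AddCommGroup V] [Module ℂ V] [Module A V] [IsScalarTower ℂ A V]
    [FiniteDimensional ℂ V] [IsSimpleModule A V]
    (W : Type) [AddCommGroup W] [Module ℂ W] [Module B W] [IsScalarTower ℂ B W]
    [FiniteDimensional ℂ W]
    (PV : A)
    (hPVcentral : ∀ a : A, PV * a = a * PV)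
    (hPVidem : PV * PV = PV)
    (hPVone : ∀ v : V, PV • v = v)
    (hPVzero : ∀ (V' : Type) [AddCommGroup V'] [Module A V'],
      IsSimpleModule A V' → ¬ Nonempty (V ≃ₗ[A] V') → ∀ v' : V', PV • v' = 0) :
    LinearMap.trace ℂ W (Algebra.lsmul ℂ ℂ W (PV : B)) =
      (Module.finrank ℂ V : ℂ) * (Module.finrank ℂ ↥(homRes B A V W) : ℂ) ∧
    (homRes B A V W = ⊥ → ∀ w : W, (PV : B) • w = 0) := by
  have : IsScalarTower ℂ A W := ⟨fun c a w => smul_assoc c (a : B) w⟩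
  let p : W →ₗ[A] W :=
    { toFun := fun w => PV • w
      map_add' := smul_add _
      map_smul' := fun a w => by simp only [RingHom.id_apply, ← mul_smul, hPVcentral] }
  let R : Submodule A W := LinearMap.range p
  have hR : ∀ w ∈ R, PV • w = w := by
    rintro _ ⟨w, rfl⟩
    change PV • PV • w = PV • w
    rw [← mul_smul, hPVidem]
  have hiso : IsIsotypicOfType A R V := by
    intro m hm
    by_contra hne
    have h0 := hPVzero m hm (fun ⟨e⟩ => hne ⟨e.symm⟩)
    have := IsSimpleModule.nontrivial A m
    obtain ⟨x, hx⟩ := exists_ne (0 : m)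
    apply hx
    rw [← h0 x]
    apply Subtype.ext; apply Subtype.ext
    exact (hR _ x.1.2).symm
  have : Module.Finite A W := Module.Finite.of_restrictScalars_finite ℂ A W
  have : Module.Finite ℂ R := inferInstanceAs (Module.Finite ℂ (R.restrictScalars ℂ))
  have : Module.Finite A R := Module.Finite.of_restrictScalars_finite ℂ A R
  obtain ⟨n, ⟨e⟩⟩ := hiso.linearEquiv_fun
  have hdim : Module.finrank ℂ R = n * Module.finrank ℂ V := by
    rw [(e.restrictScalars ℂ).finrank_eq, Module.finrank_pi_fintype]
    simp
  have htr : LinearMap.trace ℂ W (Algebra.lsmul ℂ ℂ W (PV : B)) = (Module.finrank ℂ R : ℂ) := by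
    refine LinearMap.IsProj.trace (p := R.restrictScalars ℂ) ⟨?_, ?_⟩
    · intro w; exact ⟨w, rfl⟩
    · intro w hw; exact hR w hw
  have hb := IsSimpleModule.algebraMap_end_bijective_of_isAlgClosed (A := A) (V := V) ℂ
  have := IsSimpleModule.nontrivial A V
  have hc : ∀ (a : A) (c : ℂ) (v : V), a • c • v = c • a • v := fun a c v => by
    rw [← algebraMap_smul A c v, ← algebraMap_smul A c (a • v), ← mul_smul, ← mul_smul,
      Algebra.commutes]
  let T : (Fin n → ℂ) →ₗ[ℂ] homRes B A V W :=
    { toFun := fun c => ⟨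
        { toFun := fun v => (e.symm (fun i => c i • v) : W)
          map_add' := fun v w => by
            rw [← Submodule.coe_add, ← map_add]
            congr 2; funext i; simp
          map_smul' := fun t v => by
            have : (fun i => c i • t • v) = algebraMap ℂ A t • (fun i => c i • v) := by
              funext i
              rw [Pi.smul_apply, algebraMap_smul, smul_comm]
            rw [this, map_smul, Submodule.coe_smul, algebraMap_smul]; rfl }, by
        intro a v
        change (e.symm (fun i => c i • a • v) : W) = a • (e.symm (fun i => c i • v) : W)
        rw [← Submodule.coe_smul, ← map_smul]
        congr 2; funext i; simp [hc]⟩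
      map_add' := fun c d => by
        apply Subtype.ext; apply LinearMap.ext; intro v
        change (e.symm (fun i => (c i + d i) • v) : W) =
          (e.symm (fun i => c i • v) : W) + (e.symm (fun i => d i • v) : W)
        rw [← Submodule.coe_add, ← map_add]
        congr 2; funext i; simp [add_smul]
      map_smul' := fun t c => by
        apply Subtype.ext; apply LinearMap.ext; intro v
        change (e.symm (fun i => (t * c i) • v) : W) = t • (e.symm (fun i => c i • v) : W)
        have : (fun i => (t * c i) • v) = algebraMap ℂ A t • (fun i => c i • v) := by
          funext i
          rw [Pi.smul_apply, algebraMap_smul, mul_smul]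
        rw [this, map_smul, Submodule.coe_smul, algebraMap_smul] }
  have hT : ∀ c v, (T c).1 v = (e.symm (fun i => c i • v) : W) := fun _ _ => rfl
  have hTinj : Function.Injective T := by
    intro c d h
    obtain ⟨v, hv⟩ := exists_ne (0 : V)
    have h1 : (T c).1 v = (T d).1 v := by rw [h]
    rw [hT, hT] at h1
    have h2 := e.symm.injective (Subtype.ext h1)
    funext i
    exact smul_left_injective ℂ hv (congrFun h2 i)
  have hTsurj : Function.Surjective T := by
    rintro ⟨f, hf⟩
    have hf' : ∀ (a : A) (v : V), f (a • v) = a • f v := hf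
    have hfR : ∀ v, f v ∈ R := fun v => ⟨f v, by
      change PV • f v = f v
      rw [← hf', hPVone]⟩
    let g : V →ₗ[A] R :=
      { toFun := fun v => ⟨f v, hfR v⟩
        map_add' := fun v w => Subtype.ext (f.map_add v w)
        map_smul' := fun a v => Subtype.ext (hf' a v) }
    have hg : ∀ i : Fin n, ∃ c : ℂ, ∀ v, e (g v) i = c • v := by
      intro i
      obtain ⟨c, hc⟩ := hb.2 ((LinearMap.proj i : (Fin n → V) →ₗ[A] V) ∘ₗ e.toLinearMap ∘ₗ g)
      refine ⟨c, fun v => ?_⟩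
      have := LinearMap.congr_fun hc v
      rw [Module.algebraMap_end_apply] at this
      exact this.symm
    choose c hc using hg
    refine ⟨c, ?_⟩
    apply Subtype.ext; apply LinearMap.ext; intro v
    rw [hT]
    have : (fun i => c i • v) = e (g v) := by funext i; rw [hc]
    rw [this, e.symm_apply_apply]; rfl
  have hn : Module.finrank ℂ (homRes B A V W) = n := by
    rw [← (LinearEquiv.ofBijective T ⟨hTinj, hTsurj⟩).finrank_eq]; simp
  refine ⟨?_, ?_⟩
  · rw [htr, hn, hdim]; push_cast; ring
  · intro h w
    rw [h, finrank_bot] at hn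
    subst hn
    have h0 : (⟨PV • w, w, rfl⟩ : R) = 0 := e.injective (Subsingleton.elim _ _)
    exact congrArg Subtype.val h0

/-- For an inclusion `A ⊆ B` of finite-dimensional semisimple
`ℂ`-algebras, a simple `A`-module `V` and a simple `B`-module `W`, with associated
central idempotents `P_V ∈ A`, `P_W ∈ B`, the multiplicity of `V` in `W|_A` is
`dim Hom_A(V, W|_A) = Tr(L_{P_V P_W}) / (dim V · dim W)`, and `P_V P_W = 0` iff
`Hom_A(V, W|_A) = 0`. -/
theorem stmt_10 (B : Type) [Ring B] [Algebra ℂ B]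
    [FiniteDimensional ℂ B] [IsSemisimpleRing B]
    (A : Subalgebra ℂ B) [IsSemisimpleRing A]
    -- a simple `A`-module `V`
    (V : Type) [AddCommGroup V] [Module ℂ V] [Module A V] [IsScalarTower ℂ A V]
    [FiniteDimensional ℂ V] [IsSimpleModule A V]
    -- a simple `B`-module `W`
    (W : Type) [AddCommGroup W] [Module ℂ W] [Module B W] [IsScalarTower ℂ B W]
    [FiniteDimensional ℂ W] [IsSimpleModule B W]
    -- the central idempotent of `A` attached to `V`
    (PV : A)
    (hPVcentral : ∀ a : A, PV * a = a * PV)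
    (hPVidem : PV * PV = PV)
    (hPVone : ∀ v : V, PV • v = v)
    (hPVzero : ∀ (V' : Type) [AddCommGroup V'] [Module A V'],
      IsSimpleModule A V' → ¬ Nonempty (V ≃ₗ[A] V') → ∀ v' : V', PV • v' = 0)
    -- the central idempotent of `B` attached to `W`
    (PW : B)
    (hPWcentral : ∀ b : B, PW * b = b * PW)
    (hPWidem : PW * PW = PW)
    (hPWone : ∀ w : W, PW • w = w)
    (hPWzero : ∀ (W' : Type) [AddCommGroup W'] [Module B W'],
      IsSimpleModule B W' → ¬ Nonempty (W ≃ₗ[B] W') → ∀ w' : W', PW • w' = 0) :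
    (Module.finrank ℂ ↥(homRes B A V W) : ℂ)
      = LinearMap.trace ℂ B (LinearMap.mulLeft ℂ ((PV : B) * PW))
        / ((Module.finrank ℂ V : ℂ) * (Module.finrank ℂ W : ℂ)) ∧
    ((PV : B) * PW = 0 ↔ homRes B A V W = ⊥) := by
  have hz : ∀ x : B, (∀ w : W, x • w = 0) → x * PW = 0 := by
    intro x hx
    apply aux_zero
    intro M _ _ hM m
    rw [mul_smul]
    by_cases hne : Nonempty (W ≃ₗ[B] M)
    · obtain ⟨e⟩ := hne
      obtain ⟨w, rfl⟩ := e.surjective m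
      rw [← map_smul, ← map_smul, hx, map_zero]
    · rw [hPWzero M hM hne, smul_zero]
  obtain ⟨h2, h3⟩ := aux_two B A V W PV hPVcentral hPVidem hPVone hPVzero
  refine ⟨?_, ?_, fun h => hz _ (h3 h)⟩
  · rw [aux_one B W PW hPWcentral hPWone hz, h2]
    have := IsSimpleModule.nontrivial A V
    have := IsSimpleModule.nontrivial B W
    have hV : (Module.finrank ℂ V : ℂ) ≠ 0 := Nat.cast_ne_zero.2 Module.finrank_pos.ne'
    have hW : (Module.finrank ℂ W : ℂ) ≠ 0 := Nat.cast_ne_zero.2 Module.finrank_pos.ne'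
    field_simp
  · intro h
    rw [eq_bot_iff]
    intro f hf
    rw [Submodule.mem_bot]
    apply LinearMap.ext
    intro v
    have h1 := hf PV v
    rw [hPVone, ← hPWone (f v), ← mul_smul, h, zero_smul, hPWone] at h1
    exact h1
end

section
/- Let R and R̄ be two transversals of K in G, both containing e; for r ∈ R let r̄ ∈ R̄ be the unique element with r̄ K = r K and set c_r = r^{-1} r̄ ∈ K. Then for all x ∈ K and r, s, t ∈ R: (i) x ▷̄ r̄ = \overline{x ▷ r}, i.e. x ▷̄ r̄ = (x ▷ r) c_{x▷r} as elements of G; (ii) x ◁̄ r̄ = c_{x▷r}^{-1} (x ◁ r) c_r; (iii) s̄ ·̄ t̄ = \overline{s · (c_s ▷ t)}; (iv) τ̄(s̄, t̄) = c_{s·(c_s▷t)}^{-1} τ(s, c_s ▷ t) (c_s ◁ t) c_t. -/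
/-- For two transversals `R`, `R̄` of `K ⊆ G` containing `e`, with
`r̄ ∈ R̄` the representative of `rK` and `c_r = r⁻¹ r̄ ∈ K`, the structure maps are
related by: (i) `x ▷̄ r̄ = (x ▷ r)‾`, i.e. `x ▷̄ r̄ = (x ▷ r) c_{x▷r}` in `G`;
(ii) `x ◁̄ r̄ = c_{x▷r}⁻¹ (x ◁ r) c_r`; (iii) `s̄ ·̄ t̄ = (s · (c_s ▷ t))‾`;
(iv) `τ̄(s̄, t̄) = c_{s·(c_s▷t)}⁻¹ τ(s, c_s ▷ t) (c_s ◁ t) c_t`. -/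
theorem stmt_17 (G : Type) [Group G] (K : Subgroup G)
    -- the transversal `R` and its structure maps
    (R : Set G) (hR1 : (1 : G) ∈ R)
    (hfact : ∀ g : G, ∃! p : R × K, g = (p.1 : G) * ((p.2 : K) : G))
    (act : K → R → R) (coact : K → R → K)
    (mul : R → R → R) (tau : R → R → K)
    (hact : ∀ (x : K) (r : R), (x : G) * (r : G) = (act x r : G) * ((coact x r : K) : G))
    (hmul : ∀ r s : R, (r : G) * (s : G) = (mul r s : G) * ((tau r s : K) : G))
    -- the transversal `R̄` and its structure maps
    (Rb : Set G) (hRb1 : (1 : G) ∈ Rb)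
    (hfactb : ∀ g : G, ∃! p : Rb × K, g = (p.1 : G) * ((p.2 : K) : G))
    (actb : K → Rb → Rb) (coactb : K → Rb → K)
    (mulb : Rb → Rb → Rb) (taub : Rb → Rb → K)
    (hactb : ∀ (x : K) (r : Rb),
      (x : G) * (r : G) = (actb x r : G) * ((coactb x r : K) : G))
    (hmulb : ∀ r s : Rb, (r : G) * (s : G) = (mulb r s : G) * ((taub r s : K) : G))
    -- the correspondence `r ↦ r̄` and the cochain data `c_r = r⁻¹ r̄`
    (bar : R → Rb) (c : R → K)
    (hc : ∀ r : R, (bar r : G) = (r : G) * ((c r : K) : G)) :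
    -- (i)
    (∀ (x : K) (r : R), actb x (bar r) = bar (act x r) ∧
      (actb x (bar r) : G) = (act x r : G) * ((c (act x r) : K) : G)) ∧
    -- (ii)
    (∀ (x : K) (r : R), coactb x (bar r) = (c (act x r))⁻¹ * coact x r * c r) ∧
    -- (iii)
    (∀ s t : R, mulb (bar s) (bar t) = bar (mul s (act (c s) t))) ∧
    -- (iv)
    (∀ s t : R, taub (bar s) (bar t)
      = (c (mul s (act (c s) t)))⁻¹ * tau s (act (c s) t) * (coact (c s) t) * c t) := by
  have U : ∀ (a b : Rb) (k l : K), (a : G) * (k : G) = (b : G) * (l : G) → a = b ∧ k = l := by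
    intro a b k l h
    have := (hfactb ((a : G) * (k : G))).unique (y₁ := (a, k)) (y₂ := (b, l)) rfl h
    exact Prod.mk.inj this
  have A : ∀ (x : K) (r : R), actb x (bar r) = bar (act x r) ∧
      coactb x (bar r) = (c (act x r))⁻¹ * coact x r * c r := by
    intro x r
    apply U
    rw [← hactb, hc, hc, ← mul_assoc, hact]
    push_cast
    group
  have B : ∀ s t : R, mulb (bar s) (bar t) = bar (mul s (act (c s) t)) ∧
      taub (bar s) (bar t)
      = (c (mul s (act (c s) t)))⁻¹ * tau s (act (c s) t) * (coact (c s) t) * c t := by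
    intro s t
    apply U
    have h1 := hact (c s) t
    have h2 := hmul s (act (c s) t)
    rw [← hmulb, hc, hc, hc]
    push_cast
    calc (s : G) * (c s : G) * ((t : G) * (c t : G))
        = (s : G) * ((c s : G) * (t : G)) * (c t : G) := by group
      _ = ((s : G) * (act (c s) t : G)) * (coact (c s) t : G) * (c t : G) := by
          rw [h1]; group
      _ = _ := by rw [h2]; group
  refine ⟨fun x r => ⟨(A x r).1, ?_⟩, fun x r => (A x r).2, fun s t => (B s t).1,
    fun s t => (B s t).2⟩
  rw [(A x r).1, hc]
end

section
/- Let G be the group of order 128 given as the set {1,-1} × F_2^3 × F_2^3 with multiplication (ε, a, u)(ε', b, v) = (ε ε' (-1)^{Σ_{i≥j} a_i b_j + Σ_i u_i b_i}, a + b, u + v), where F_2 is the field of two elements (this realizes Cl_3 ⋊ Z_2^3, with (ε, a, u) corresponding to ε e_a g^u). Let K = {(1, 0, u) : u ∈ F_2^3} ≅ Z_2^3 and let R = {(ε, a, n(a)) : ε ∈ {1,-1}, a ∈ F_2^3} where n(a) = (a_2 a_3, a_1 a_3, a_1 a_2). Then: (1) R is a transversal of the left cosets of K containing the identity (1,0,0);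 (2) the quasi-action ◁ is trivial: x ◁ r = x for all x ∈ K, r ∈ R; (3) the action ▷ is (1, 0, u) ▷ (ε, a, n(a)) = (ε (-1)^{Σ_i u_i a_i}, a, n(a)); (4) the induced product on R is (ε, a, n(a)) · (ε', b, n(b)) = (ε ε' (-1)^{f(a,b)}, a + b, n(a+b)) with f(a,b) = Σ_{i≥j} a_i b_j + a_1 a_2 b_3 + a_1 b_2 a_3 + b_1 a_2 a_3, so (R, ·) is the octonion quasigroup G_O; and (5) the cocycle is τ((ε, a, n(a)), (ε', b, n(b))) = (1, 0, a × b), where a × b = (a_2 b_3 + a_3 b_2, a_3 b_1 + a_1 b_3, a_1 b_2 + a_2 b_1). -/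
lemma aux_val (a b : ZMod 2) : (a * b).val = a.val * b.val := by
  revert a b; decide

lemma aux_add (w : Fin 3 → ZMod 2) : w + w = 0 := by
  funext i
  exact CharTwo.add_self_eq_zero (w i)

/-- For the group `G = Cl₃ ⋊ ℤ₂³` of order 128, presented on the
set `{1,-1} × F₂³ × F₂³` with multiplication
`(ε,a,u)(ε',b,v) = (εε'(-1)^{Σ_{i≥j}aᵢbⱼ + Σᵢ uᵢbᵢ}, a+b, u+v)`, the subgroup
`K = {(1,0,u)} ≅ ℤ₂³` and the transversal `R = {(ε,a,n(a))}` with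
`n(a) = (a₂a₃, a₁a₃, a₁a₂)`: (1) `R` is a transversal containing the identity;
(2) `◁` is trivial; (3) `(1,0,u) ▷ (ε,a,n(a)) = (ε(-1)^{Σᵢuᵢaᵢ}, a, n(a))`;
(4) `(ε,a,n(a))·(ε',b,n(b)) = (εε'(-1)^{f(a,b)}, a+b, n(a+b))` with
`f(a,b) = Σ_{i≥j}aᵢbⱼ + a₁a₂b₃ + a₁b₂a₃ + b₁a₂a₃`, so `(R,·)` is the octonion
quasigroup `G_𝕆`; (5) `τ((ε,a,n(a)),(ε',b,n(b))) = (1,0,a×b)`. -/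
theorem stmt_19 (G : Type) [Group G]
    (f : ℤˣ × (Fin 3 → ZMod 2) × (Fin 3 → ZMod 2) ≃ G)
    (hf : ∀ (ε ε' : ℤˣ) (a b u v : Fin 3 → ZMod 2),
      f (ε, a, u) * f (ε', b, v)
        = f (ε * ε' * (-1) ^ ((∑ i : Fin 3, ∑ j : Fin 3,
              if j ≤ i then (a i).val * (b j).val else 0)
            + ∑ i : Fin 3, (u i).val * (b i).val),
          a + b, u + v))
    (K : Subgroup G)
    (hK : ∀ g : G, g ∈ K ↔ ∃ u : Fin 3 → ZMod 2, g = f (1, 0, u))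
    (n : (Fin 3 → ZMod 2) → (Fin 3 → ZMod 2))
    (hn : n = fun a => ![a 1 * a 2, a 0 * a 2, a 0 * a 1])
    (cross : (Fin 3 → ZMod 2) → (Fin 3 → ZMod 2) → (Fin 3 → ZMod 2))
    (hcross : cross = fun a b =>
      ![a 1 * b 2 + a 2 * b 1, a 2 * b 0 + a 0 * b 2, a 0 * b 1 + a 1 * b 0])
    (foct : (Fin 3 → ZMod 2) → (Fin 3 → ZMod 2) → ℕ)
    (hfoct : foct = fun a b =>
      (∑ i : Fin 3, ∑ j : Fin 3, if j ≤ i then (a i).val * (b j).val else 0)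
        + (a 0).val * (a 1).val * (b 2).val
        + (a 0).val * (b 1).val * (a 2).val
        + (b 0).val * (a 1).val * (a 2).val)
    (R : Set G)
    (hR : R = {g : G | ∃ (ε : ℤˣ) (a : Fin 3 → ZMod 2), g = f (ε, a, n a)}) :
    -- (1) `R` is a transversal of the left cosets of `K` containing the identity
    ((1 : G) ∈ R ∧ ∀ g : G, ∃! p : R × K, g = (p.1 : G) * ((p.2 : K) : G)) ∧
    -- (2)-(5): the induced structure maps
    (∀ (act : K → R → R) (coact : K → R → K)
        (mul : R → R → R) (tau : R → R → K),
      (∀ (x : K) (r : R),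
        (x : G) * (r : G) = (act x r : G) * ((coact x r : K) : G)) →
      (∀ r s : R, (r : G) * (s : G) = (mul r s : G) * ((tau r s : K) : G)) →
      -- (2) the quasi-action `◁` is trivial
      (∀ (x : K) (r : R), coact x r = x) ∧
      -- (3) the action `▷`
      (∀ (x : K) (r : R) (ε : ℤˣ) (a u : Fin 3 → ZMod 2),
        (x : G) = f (1, 0, u) → (r : G) = f (ε, a, n a) →
        (act x r : G)
          = f (ε * (-1) ^ (∑ i : Fin 3, (u i).val * (a i).val), a, n a)) ∧
      -- (4) the product `·`, making `(R,·)` the octonion quasigroup `G_𝕆`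
      (∀ (r s : R) (ε ε' : ℤˣ) (a b : Fin 3 → ZMod 2),
        (r : G) = f (ε, a, n a) → (s : G) = f (ε', b, n b) →
        (mul r s : G) = f (ε * ε' * (-1) ^ (foct a b), a + b, n (a + b))) ∧
      -- (5) the cocycle `τ`
      (∀ (r s : R) (ε ε' : ℤˣ) (a b : Fin 3 → ZMod 2),
        (r : G) = f (ε, a, n a) → (s : G) = f (ε', b, n b) →
        ((tau r s : K) : G) = f (1, 0, cross a b))) := by
  have hrk : ∀ (ε : ℤˣ) (a u w : Fin 3 → ZMod 2),
      f (ε, a, u) * f (1, 0, w) = f (ε, a, u + w) := by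
    intro ε a u w
    rw [hf]
    simp
  have hmem : ∀ r : R, ∃ (ε : ℤˣ) (a : Fin 3 → ZMod 2), (r : G) = f (ε, a, n a) := by
    rintro ⟨r, h⟩
    rw [hR] at h
    exact h
  have hmemK : ∀ x : K, ∃ u : Fin 3 → ZMod 2, (x : G) = f (1, 0, u) :=
    fun x => (hK x).1 x.2
  -- factor uniqueness
  have key : ∀ (r : R) (x : K) (ε : ℤˣ) (a u : Fin 3 → ZMod 2),
      f (ε, a, u) = (r : G) * (x : G) →
      (r : G) = f (ε, a, n a) ∧ (x : G) = f (1, 0, n a + u) := by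
    intro r x ε a u h
    obtain ⟨δ, b, hr⟩ := hmem r
    obtain ⟨w, hx⟩ := hmemK x
    rw [hr, hx, hrk] at h
    have h2 := f.injective h
    simp only [Prod.mk.injEq] at h2
    obtain ⟨rfl, rfl, rfl⟩ := h2
    refine ⟨hr, ?_⟩
    rw [hx, ← add_assoc, aux_add, zero_add]
  have hn0 : n 0 = 0 := by
    rw [hn]; funext i; fin_cases i <;> simp
  have hone : f (1, 0, 0) = 1 := by
    have h := hrk 1 0 0 0
    rw [add_zero] at h
    exact mul_eq_left.mp h
  have hxr : ∀ (ε : ℤˣ) (a u : Fin 3 → ZMod 2), f (1, 0, u) * f (ε, a, n a)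
      = f (ε * (-1) ^ (∑ i : Fin 3, (u i).val * (a i).val), a, u + n a) := by
    intro ε a u
    rw [hf]
    simp
  have hrs : ∀ (ε ε' : ℤˣ) (a b : Fin 3 → ZMod 2), f (ε, a, n a) * f (ε', b, n b)
      = f (ε * ε' * (-1) ^ (foct a b), a + b, n a + n b) := by
    intro ε ε' a b
    rw [hf]
    have : (∑ i : Fin 3, ∑ j : Fin 3, if j ≤ i then (a i).val * (b j).val else 0)
        + ∑ i : Fin 3, (n a i).val * (b i).val = foct a b := by
      rw [hfoct, hn]
      simp only [Fin.sum_univ_three (fun i => ((![a 1 * a 2, a 0 * a 2, a 0 * a 1] : Fin 3 → ZMod 2) i).val * (b i).val),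
        Matrix.cons_val, aux_val]
      ring
    rw [this]
  have hcr : ∀ a b : Fin 3 → ZMod 2, n (a + b) + (n a + n b) = cross a b := by
    intro a b
    rw [hn, hcross]
    have h2 : (2 : ZMod 2) = 0 := rfl
    funext i
    fin_cases i <;> simp <;> ring_nf <;> simp [h2]
  refine ⟨⟨?_, ?_⟩, ?_⟩
  · rw [hR]
    exact ⟨1, 0, by rw [hn0, hone]⟩
  · intro g
    obtain ⟨⟨ε, a, u⟩, rfl⟩ := f.surjective g
    have hr0 : f (ε, a, n a) ∈ R := by rw [hR]; exact ⟨ε, a, rfl⟩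
    have hk0 : f (1, 0, n a + u) ∈ K := (hK _).2 ⟨_, rfl⟩
    refine ⟨(⟨_, hr0⟩, ⟨_, hk0⟩), ?_, ?_⟩
    · show f (ε, a, u) = f (ε, a, n a) * f (1, 0, n a + u)
      rw [hrk, ← add_assoc, aux_add, zero_add]
    · rintro ⟨r, x⟩ h
      obtain ⟨h1, h2⟩ := key r x ε a u h
      exact Prod.ext (Subtype.ext h1) (Subtype.ext h2)
  · intro act coact mul tau hact hmul
    refine ⟨?_, ?_, ?_, ?_⟩
    · intro x r
      obtain ⟨ε, a, hr⟩ := hmem r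
      obtain ⟨u, hx⟩ := hmemK x
      have h := hact x r
      rw [hr, hx, hxr] at h
      apply Subtype.ext
      rw [(key _ _ _ _ _ h).2, hx, add_left_comm, aux_add, add_zero]
    · intro x r ε a u hx hr
      have h := hact x r
      rw [hr, hx, hxr] at h
      exact (key _ _ _ _ _ h).1
    · intro r s ε ε' a b hr hs
      have h := hmul r s
      rw [hr, hs, hrs] at h
      exact (key _ _ _ _ _ h).1
    · intro r s ε ε' a b hr hs
      have h := hmul r s
      rw [hr, hs, hrs] at h
      rw [(key _ _ _ _ _ h).2, hcr]
end
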